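/- arXiv:math-ph/0110028 — 2 statements merged into one kernel-verified Lean document; each statement's English description precedes it below -/
import Mathlib

section
/- The theta group admits the presentation ⟨s, p, t | p² = 1, s²p = 1, sp = ps, tp = pt⟩: the group homomorphism from the group presented by generators s, p, t and relators p², s²p, sps⁻¹p⁻¹, tpt⁻¹p⁻¹ to Γ_θ sending s ↦ S⁺ = [[0,−1],[1,0]], p ↦ P = [[−1,0],[0,−1]], t ↦ T₂⁺ = [[1,0],[2,1]] is a group isomorphism. In particular {S⁺, P, T₂⁺} generates Γ_θ and the only relations among S⁺, P, T₂⁺ are P² = 1, (S⁺)²P = 1, S⁺P = PS⁺ and T₂⁺P = PT₂⁺. -/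
open Matrix

abbrev SL2Z := Matrix.SpecialLinearGroup (Fin 2) ℤ

/-- Membership in the theta group `Γ_θ`: `a b ≡ c d ≡ 0 (mod 2)`. -/
def IsTheta (A : SL2Z) : Prop :=
  (2 : ℤ) ∣ (A.1 0 0 * A.1 0 1) ∧ (2 : ℤ) ∣ (A.1 1 0 * A.1 1 1)

private lemma zmod2_mul : ∀ a b e f g h : ZMod 2,
    a * b = 0 → e * f = 0 → g * h = 0 →
      (a * e + b * g) * (a * f + b * h) = 0 := by decide

private lemma zmod2_inv : ∀ a b c d : ZMod 2, a * b = 0 → c * d = 0 →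
    a * d - b * c = 1 → d * (-b) = 0 ∧ (-c) * a = 0 := by decide

private lemma dvd_iff_zmod2 (x : ℤ) : (2 : ℤ) ∣ x ↔ ((x : ZMod 2) = 0) := by
  simpa using (ZMod.intCast_zmod_eq_zero_iff_dvd x 2).symm

/-- The theta group `Γ_θ` as a subgroup of `SL(2,ℤ)`. -/
def ThetaSubgroup : Subgroup SL2Z where
  carrier := {A | IsTheta A}
  one_mem' := by
    constructor <;>
      simp [Matrix.SpecialLinearGroup.coe_one, Matrix.one_apply]
  mul_mem' := by
    rintro A B ⟨hA1, hA2⟩ ⟨hB1, hB2⟩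
    rw [dvd_iff_zmod2] at hA1 hA2 hB1 hB2
    push_cast at hA1 hA2 hB1 hB2
    have hmul : (A * B).1 = A.1 * B.1 := rfl
    constructor <;>
      · rw [dvd_iff_zmod2, hmul]
        rw [Matrix.mul_apply, Matrix.mul_apply, Fin.sum_univ_two, Fin.sum_univ_two]
        push_cast
        first
          | exact zmod2_mul _ _ _ _ _ _ hA1 hB1 hB2
          | exact zmod2_mul _ _ _ _ _ _ hA2 hB1 hB2
  inv_mem' := by
    rintro A ⟨hA1, hA2⟩
    rw [dvd_iff_zmod2] at hA1 hA2
    push_cast at hA1 hA2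
    have hdet := A.2
    rw [Matrix.det_fin_two] at hdet
    have hdet2 : (A.1 0 0 : ZMod 2) * (A.1 1 1 : ZMod 2) -
        (A.1 0 1 : ZMod 2) * (A.1 1 0 : ZMod 2) = 1 := by
      have := congrArg (fun x : ℤ => (x : ZMod 2)) hdet
      push_cast at this
      simpa using this
    obtain ⟨h1, h2⟩ := zmod2_inv (A.1 0 0 : ZMod 2) (A.1 0 1 : ZMod 2)
      (A.1 1 0 : ZMod 2) (A.1 1 1 : ZMod 2) hA1 hA2 hdet2
    rw [Matrix.SpecialLinearGroup.SL2_inv_expl A]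
    constructor <;>
      · rw [dvd_iff_zmod2]
        simp only [Matrix.cons_val_zero, Matrix.cons_val_one, Matrix.head_cons,
          Matrix.head_fin_const]
        push_cast
        first | exact h1 | exact h2

/-- `S⁺ = [[0,−1],[1,0]]`. -/
def Smat : SL2Z := ⟨!![0, -1; 1, 0], by norm_num [Matrix.det_fin_two_of]⟩

/-- `T₂⁺ = [[1,0],[2,1]]`. -/
def Tmat : SL2Z := ⟨!![1, 0; 2, 1], by norm_num [Matrix.det_fin_two_of]⟩

/-- `P = −I`. -/
def Pmat : SL2Z := ⟨!![-1, 0; 0, -1], by norm_num [Matrix.det_fin_two_of]⟩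

lemma Smat_mem : Smat ∈ ThetaSubgroup := by
  constructor <;> norm_num [Smat]

lemma Tmat_mem : Tmat ∈ ThetaSubgroup := by
  constructor <;> norm_num [Tmat]

lemma Pmat_mem : Pmat ∈ ThetaSubgroup := by
  constructor <;> norm_num [Pmat]

/-- The relators `p²`, `s²p`, `sps⁻¹p⁻¹`, `tpt⁻¹p⁻¹` for the presentation
`⟨s, p, t | p² = 1, s²p = 1, sp = ps, tp = pt⟩` (with `s = of 0`, `p = of 1`, `t = of 2`). -/
def thetaRels : Set (FreeGroup (Fin 3)) :=
  { FreeGroup.of 1 * FreeGroup.of 1,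
    FreeGroup.of 0 * FreeGroup.of 0 * FreeGroup.of 1,
    FreeGroup.of 0 * FreeGroup.of 1 * (FreeGroup.of 0)⁻¹ * (FreeGroup.of 1)⁻¹,
    FreeGroup.of 2 * FreeGroup.of 1 * (FreeGroup.of 2)⁻¹ * (FreeGroup.of 1)⁻¹ }

lemma SL2Z_val_mul (A B : SL2Z) : (A * B).1 = A.1 * B.1 := rfl

lemma Tmat_zpow (k : ℤ) : (Tmat ^ k).1 = !![1, 0; 2 * k, 1] := by
  induction k using Int.induction_on with
  | zero => ext i j; fin_cases i <;> fin_cases j <;> simp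
  | succ n ih =>
    rw [_root_.zpow_add_one, SL2Z_val_mul, ih]
    ext i j; fin_cases i <;> fin_cases j <;> simp [Tmat, mul_add]
  | pred n ih =>
    rw [_root_.zpow_sub_one, SL2Z_val_mul, ih, show Tmat⁻¹.1 = !![1, 0; -2, 1] by decide]
    ext i j; fin_cases i <;> fin_cases j <;> simp
    ring

lemma Tmat_zpow_mul_zero (k : ℤ) (A : SL2Z) (j : Fin 2) : (Tmat ^ k * A).1 0 j = A.1 0 j := by
  rw [SL2Z_val_mul, Tmat_zpow]
  simp [Matrix.mul_apply, Fin.sum_univ_two]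

lemma Tmat_zpow_mul_one (k : ℤ) (A : SL2Z) (j : Fin 2) :
    (Tmat ^ k * A).1 1 j = A.1 1 j + 2 * k * A.1 0 j := by
  rw [SL2Z_val_mul, Tmat_zpow]
  simp [Matrix.mul_apply, Fin.sum_univ_two]
  ring

lemma Smat_mul_zero (A : SL2Z) (j : Fin 2) : (Smat * A).1 0 j = -A.1 1 j := by
  rw [SL2Z_val_mul]
  simp [Smat, Matrix.mul_apply, Fin.sum_univ_two]

lemma Smat_mul_one (A : SL2Z) (j : Fin 2) : (Smat * A).1 1 j = A.1 0 j := by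
  rw [SL2Z_val_mul]
  simp [Smat, Matrix.mul_apply, Fin.sum_univ_two]

/-- The homomorphism from the presented group to `SL(2,ℤ)`. -/
def thetaHom : PresentedGroup thetaRels →* SL2Z :=
  PresentedGroup.toGroup (f := ![Smat, Pmat, Tmat]) (by
    intro r hr
    rcases hr with rfl | rfl | rfl | rfl <;> simp <;> decide)

lemma thetaHom_of (i : Fin 3) : thetaHom (PresentedGroup.of i) = ![Smat, Pmat, Tmat] i :=
  PresentedGroup.toGroup.of _

namespace ThetaPresentation

/-- The generator `s`. -/
abbrev s : PresentedGroup thetaRels := PresentedGroup.of 0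

/-- The generator `p`. -/
abbrev p : PresentedGroup thetaRels := PresentedGroup.of 1

/-- The generator `t`. -/
abbrev t : PresentedGroup thetaRels := PresentedGroup.of 2

lemma p_mul_p : p * p = 1 :=
  PresentedGroup.one_of_mem (rels := thetaRels) (by simp [thetaRels])

lemma s_mul_s_mul_p : s * s * p = 1 :=
  PresentedGroup.one_of_mem (rels := thetaRels)
    (x := FreeGroup.of 0 * FreeGroup.of 0 * FreeGroup.of 1) (by simp [thetaRels])

lemma t_mul_p : t * p = p * t := by
  have h : t * p * t⁻¹ * p⁻¹ = 1 := PresentedGroup.one_of_mem (rels := thetaRels)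
    (x := FreeGroup.of 2 * FreeGroup.of 1 * (FreeGroup.of 2)⁻¹ * (FreeGroup.of 1)⁻¹)
    (by simp [thetaRels])
  rwa [mul_inv_eq_one, mul_inv_eq_iff_eq_mul] at h

lemma s_sq : s ^ 2 = p := by
  rw [sq, mul_eq_one_iff_eq_inv.1 s_mul_s_mul_p, ← mul_eq_one_iff_eq_inv.1 p_mul_p]

lemma s_pow_four : s ^ 4 = 1 := by
  rw [show 4 = 2 * 2 from rfl, pow_mul, s_sq, sq, p_mul_p]

lemma thetaHom_s : thetaHom s = Smat := thetaHom_of 0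

lemma thetaHom_t : thetaHom t = Tmat := thetaHom_of 2

/-- Alternating words `s t^kₙ ⋯ s t^k₁` with all exponents nonzero. -/
inductive Reduced : PresentedGroup thetaRels → Prop
  | one : Reduced 1
  | step (k : ℤ) (hk : k ≠ 0) (u : PresentedGroup thetaRels) (hu : Reduced u) :
      Reduced (s * t ^ k * u)

lemma Reduced.commute {u : PresentedGroup thetaRels} (hu : Reduced u) : Commute (s ^ 2) u := by
  induction hu with
  | one => exact Commute.one_right _
  | step k hk u hu ih =>
    have ht : Commute (s ^ 2) t := by rw [s_sq]; exact t_mul_p.symm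
    exact (((Commute.refl s).pow_left 2).mul_right (ht.zpow_right k)).mul_right ih

/-- Elements of the form `t^k u s^j` with `u` a reduced alternating word. -/
def HasNormalForm (g : PresentedGroup thetaRels) : Prop :=
  ∃ (k : ℤ) (u : PresentedGroup thetaRels) (j : ℕ), Reduced u ∧ g = t ^ k * u * s ^ j

lemma HasNormalForm.t_zpow_mul {g : PresentedGroup thetaRels} (hg : HasNormalForm g) (m : ℤ) :
    HasNormalForm (t ^ m * g) := by
  obtain ⟨k, u, j, hu, rfl⟩ := hg
  exact ⟨m + k, u, j, hu, by rw [_root_.zpow_add]; simp only [mul_assoc]⟩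

lemma HasNormalForm.s_mul {g : PresentedGroup thetaRels} (hg : HasNormalForm g) :
    HasNormalForm (s * g) := by
  obtain ⟨k, u, j, hu, rfl⟩ := hg
  by_cases hk : k = 0
  · subst hk
    cases hu with
    | one => exact ⟨0, 1, j + 1, .one, by simp [pow_succ']⟩
    | step m hm v hv =>
      refine ⟨m, v, 2 + j, hv, ?_⟩
      have hc : s ^ 2 * (t ^ m * v) = t ^ m * v * s ^ 2 := by
        have ht : Commute (s ^ 2) t := by rw [s_sq]; exact t_mul_p.symm
        exact (ht.zpow_right m).mul_right hv.commute
      calc s * (t ^ (0 : ℤ) * (s * t ^ m * v) * s ^ j) = s ^ 2 * (t ^ m * v) * s ^ j := by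
            rw [zpow_zero, sq]; simp only [one_mul, mul_assoc]
        _ = t ^ m * v * s ^ (2 + j) := by rw [hc, pow_add, mul_assoc]
  · exact ⟨0, _, j, .step k hk u hu, by simp only [zpow_zero, one_mul, mul_assoc]⟩

lemma HasNormalForm.s_pow_mul {g : PresentedGroup thetaRels} (hg : HasNormalForm g) (n : ℕ) :
    HasNormalForm (s ^ n * g) := by
  induction n with
  | zero => simpa using hg
  | succ n ih => rw [pow_succ', mul_assoc]; exact ih.s_mul

lemma s_inv : s⁻¹ = s ^ 3 := inv_eq_of_mul_eq_one_right (by rw [← pow_succ', s_pow_four])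

lemma hasNormalForm (g : PresentedGroup thetaRels) : HasNormalForm g := by
  have hg : g ∈ Subgroup.closure (Set.range (PresentedGroup.of (rels := thetaRels))) := by
    rw [PresentedGroup.closure_range_of]; trivial
  induction hg using Subgroup.closure_induction_left with
  | one => exact ⟨0, 1, 0, .one, by simp⟩
  | mul_left x hx y hy ih =>
    obtain ⟨i, rfl⟩ := hx
    fin_cases i
    · exact ih.s_mul
    · change HasNormalForm (p * y)
      rw [← s_sq]; exact ih.s_pow_mul 2
    · simpa using ih.t_zpow_mul 1
  | inv_mul_cancel x hx y hy ih =>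
    obtain ⟨i, rfl⟩ := hx
    fin_cases i
    · change HasNormalForm (s⁻¹ * y)
      rw [s_inv]; exact ih.s_pow_mul 3
    · change HasNormalForm (p⁻¹ * y)
      rw [← s_sq, ← inv_pow, s_inv, ← pow_mul]; exact ih.s_pow_mul 6
    · simpa using ih.t_zpow_mul (-1)

lemma abs_lt_abs_add {a c k : ℤ} (h : |c| < |a|) (hk : k ≠ 0) : |a| < |c + 2 * k * a| := by
  have hk1 : 1 ≤ |k| := Int.one_le_abs hk
  have h1 : |2 * k * a| = 2 * |k| * |a| := by rw [abs_mul, abs_mul]; rfl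
  have h2 : |2 * k * a| ≤ |c + 2 * k * a| + |c| := by
    simpa using abs_sub (c + 2 * k * a) c
  nlinarith [abs_nonneg a]

lemma Reduced.column {u : PresentedGroup thetaRels} (hu : Reduced u) :
    |(thetaHom u).1 1 0| < |(thetaHom u).1 0 0| ∧ (u = 1 ∨ 2 ≤ |(thetaHom u).1 0 0|) := by
  induction hu with
  | one => simp
  | step k hk u hu ih =>
    have h := abs_lt_abs_add ih.1 hk
    rw [map_mul, map_mul, map_zpow, thetaHom_s, thetaHom_t, mul_assoc, Smat_mul_zero,
      Smat_mul_one, Tmat_zpow_mul_zero, Tmat_zpow_mul_one, abs_neg]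
    have := abs_nonneg ((thetaHom u).1 1 0)
    exact ⟨h, .inr (by linarith [ih.1])⟩

lemma thetaHom_injective : Function.Injective thetaHom := by
  rw [injective_iff_map_eq_one]
  intro g hg
  obtain ⟨k, u, j, hu, rfl⟩ := hasNormalForm g
  obtain ⟨i, hi, hij⟩ : ∃ i < 4, s ^ j = (s ^ i)⁻¹ := by
    have hj : s ^ j = s ^ (j % 4) := pow_eq_pow_mod j s_pow_four
    have hj4 : j % 4 < 4 := Nat.mod_lt _ (by norm_num)
    rw [hj]
    refine ⟨(4 - j % 4) % 4, Nat.mod_lt _ (by norm_num), eq_inv_of_mul_eq_one_left ?_⟩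
    rw [← pow_eq_pow_mod (4 - j % 4) s_pow_four, ← pow_add, Nat.add_sub_cancel' hj4.le, s_pow_four]
  rw [hij] at hg ⊢
  rw [map_mul, map_inv, mul_inv_eq_one, map_mul, map_zpow, map_pow, thetaHom_s, thetaHom_t] at hg
  obtain ⟨hlt, hor⟩ := hu.column
  have h0 := Tmat_zpow_mul_zero k (thetaHom u) 0
  have h1 := Tmat_zpow_mul_one k (thetaHom u) 0
  rw [hg] at h0 h1
  have hle : |(Smat ^ i).1 0 0| ≤ 1 := by
    interval_cases i <;> decide
  rcases hor with rfl | h2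
  · rw [map_one] at h0 h1
    have hi0 : i = 0 := by
      interval_cases i
      · rfl
      all_goals exact absurd h0 (by decide)
    subst hi0
    have hk : k = 0 := by simpa using h1
    simp [hk]
  · rw [← h0] at h2
    omega

lemma thetaHom_range_le : thetaHom.range ≤ ThetaSubgroup := by
  rw [MonoidHom.range_eq_map, ← PresentedGroup.closure_range_of, MonoidHom.map_closure,
    Subgroup.closure_le]
  rintro _ ⟨_, ⟨i, rfl⟩, rfl⟩
  rw [thetaHom_of]
  fin_cases i
  exacts [Smat_mem, Pmat_mem, Tmat_mem]

lemma Smat_mem_range : Smat ∈ thetaHom.range := ⟨s, thetaHom_s⟩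

lemma Tmat_mem_range : Tmat ∈ thetaHom.range := ⟨t, thetaHom_t⟩

lemma Pmat_mem_range : Pmat ∈ thetaHom.range := ⟨p, thetaHom_of 1⟩

/-- Division with remainder by `2 * c`, with remainder of absolute value at most `|c|`. -/
lemma exists_abs_add_le (a : ℤ) {c : ℤ} (hc : c ≠ 0) : ∃ k : ℤ, |a + 2 * k * c| ≤ |c| := by
  have h1 := Int.emod_add_mul_ediv a (2 * c)
  have h2 := Int.emod_nonneg a (b := 2 * c) (by simpa using hc)
  have h3 := Int.emod_lt_abs a (b := 2 * c) (by simpa using hc)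
  rw [abs_mul, abs_two] at h3
  rcases le_or_gt (a % (2 * c)) |c| with h | h
  · refine ⟨-(a / (2 * c)), ?_⟩
    rw [show a + 2 * -(a / (2 * c)) * c = a % (2 * c) by linarith, abs_of_nonneg h2]
    exact h
  · refine ⟨-(a / (2 * c)) - SignType.sign c, ?_⟩
    have h4 : (SignType.sign c : ℤ) * c = |c| := sign_mul_self c
    rw [show a + 2 * (-(a / (2 * c)) - SignType.sign c) * c = a % (2 * c) - 2 * |c| by
      linarith, abs_le]
    constructor <;> linarith

lemma abs_ne_abs_of_isTheta {A : SL2Z} (hA : IsTheta A) : |A.1 0 0| ≠ |A.1 1 0| := by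
  obtain ⟨h1, h2⟩ := hA
  have hdet := A.2
  rw [det_fin_two] at hdet
  intro h
  have hpar : (2 : ℤ) ∣ A.1 0 0 - A.1 1 0 := by
    rcases abs_eq_abs.1 h with h | h <;> omega
  rw [Int.prime_two.dvd_mul] at h1 h2
  have hev : (2 : ℤ) ∣ A.1 0 0 * A.1 1 1 - A.1 0 1 * A.1 1 0 := by
    rcases h1 with h1 | h1
    · exact dvd_sub (h1.mul_right _) ((by omega : (2 : ℤ) ∣ A.1 1 0).mul_left _)
    · rcases h2 with h2 | h2
      · exact dvd_sub ((by omega : (2 : ℤ) ∣ A.1 0 0).mul_right _) (h2.mul_left _)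
      · exact dvd_sub (h2.mul_left _) (h1.mul_right _)
  rw [hdet] at hev
  omega

lemma mem_range_of_lower_left_eq_zero {A : SL2Z} (hA : IsTheta A) (hc : A.1 1 0 = 0) :
    A ∈ thetaHom.range := by
  have hdet := A.2
  rw [det_fin_two, hc, mul_zero, sub_zero] at hdet
  obtain ⟨m, hm⟩ := hA.1
  obtain ⟨ha, hd⟩ | ⟨ha, hd⟩ := Int.mul_eq_one_iff_eq_one_or_neg_one.1 hdet
  · have : A = Smat * (Tmat ^ (-m) * (Smat * Pmat)) := by
      ext i j
      rw [ha] at hm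
      fin_cases i <;> fin_cases j <;>
        simp only [Fin.zero_eta, Fin.mk_one, Fin.isValue, Smat_mul_zero, Smat_mul_one,
          Tmat_zpow_mul_zero, Tmat_zpow_mul_one] <;>
        simp [Pmat, ha, hd, hc]
      linarith
    rw [this]
    exact mul_mem Smat_mem_range (mul_mem (zpow_mem Tmat_mem_range _)
      (mul_mem Smat_mem_range Pmat_mem_range))
  · have : A = Smat * (Tmat ^ (-m) * Smat) := by
      ext i j
      rw [ha] at hm
      fin_cases i <;> fin_cases j <;>
        simp only [Fin.zero_eta, Fin.mk_one, Fin.isValue, Smat_mul_zero, Smat_mul_one,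
          Tmat_zpow_mul_zero, Tmat_zpow_mul_one] <;>
        simp [Smat, ha, hd, hc]
      linarith
    rw [this]
    exact mul_mem Smat_mem_range (mul_mem (zpow_mem Tmat_mem_range _) Smat_mem_range)

lemma le_thetaHom_range : ThetaSubgroup ≤ thetaHom.range := by
  intro A hA
  induction h : (A.1 1 0).natAbs using Nat.strong_induction_on generalizing A with
  | _ n ih =>
    by_cases hc : A.1 1 0 = 0
    · exact mem_range_of_lower_left_eq_zero hA hc
    · obtain ⟨k, hk⟩ := exists_abs_add_le (A.1 0 0) hc
      have hB : Tmat ^ (-k) * (Smat * A) ∈ ThetaSubgroup :=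
        mul_mem (zpow_mem Tmat_mem _) (mul_mem Smat_mem hA)
      have hne := abs_ne_abs_of_isTheta hB
      have h1 := Tmat_zpow_mul_one (-k) (Smat * A) 0
      rw [Smat_mul_one, Smat_mul_zero] at h1
      rw [Tmat_zpow_mul_zero, Smat_mul_zero, abs_neg, h1] at hne
      rw [show A.1 0 0 + 2 * -k * -A.1 1 0 = A.1 0 0 + 2 * k * A.1 1 0 by ring] at h1 hne
      have hmem := ih _ (by rw [← h, h1]; zify; exact lt_of_le_of_ne hk hne.symm) hB rfl
      rwa [Subgroup.mul_mem_cancel_left _ (zpow_mem Tmat_mem_range _),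
        Subgroup.mul_mem_cancel_left _ Smat_mem_range] at hmem

end ThetaPresentation

/-- `Γ_θ` admits the presentation `⟨s, p, t | p² = 1, s²p = 1, sp = ps,
tp = pt⟩`: there is a group isomorphism from the presented group to `Γ_θ` sending
`s ↦ S⁺`, `p ↦ P`, `t ↦ T₂⁺`. In particular `{S⁺, P, T₂⁺}` generates `Γ_θ` and these are
the only relations among them. -/
theorem theta_presentation :
    ∃ φ : PresentedGroup thetaRels ≃* ThetaSubgroup,
      φ (PresentedGroup.of 0) = ⟨Smat, Smat_mem⟩ ∧
      φ (PresentedGroup.of 1) = ⟨Pmat, Pmat_mem⟩ ∧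
      φ (PresentedGroup.of 2) = ⟨Tmat, Tmat_mem⟩ :=
  ⟨(MonoidHom.ofInjective ThetaPresentation.thetaHom_injective).trans
    (MulEquiv.subgroupCongr
      (le_antisymm ThetaPresentation.thetaHom_range_le ThetaPresentation.le_thetaHom_range)),
    Subtype.ext (thetaHom_of 0), Subtype.ext (thetaHom_of 1), Subtype.ext (thetaHom_of 2)⟩
end

section
/- Let PΓ_θ = Γ_θ/Λ, where Λ = {I, −I} is the centre of the theta group, and let S and T₂ denote the images of S⁺ = [[0,−1],[1,0]] and T₂⁺ = [[1,0],[2,1]] in PΓ_θ. Then PΓ_θ has the presentation ⟨S, T₂ | S² = 1⟩: the homomorphism from the group presented by two generators s, t and the single relator s² to PΓ_θ sending s ↦ S and t ↦ T₂ is a group isomorphism. -/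
open Matrix

/-- `−I` as an element of `Γ_θ`. -/
def negIT : ThetaSubgroup := ⟨Pmat, Pmat_mem⟩

lemma Pmat_coe : Pmat.1 = -1 := by
  ext i j
  fin_cases i <;> fin_cases j <;> simp [Pmat]

lemma negIT_central (g : ThetaSubgroup) : Commute g negIT := by
  have h : (g : SL2Z) * Pmat = Pmat * (g : SL2Z) := by
    apply Subtype.ext
    show (g : SL2Z).1 * Pmat.1 = Pmat.1 * (g : SL2Z).1
    rw [Pmat_coe, mul_neg_one, neg_one_mul]
  exact Subtype.ext (Subtype.ext (congrArg (fun x : SL2Z => x.1) h))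

/-- `Λ = {I, −I}`, the centre of `Γ_θ`, as the subgroup generated by `−I`. -/
def LambdaSub : Subgroup ThetaSubgroup := Subgroup.zpowers negIT

instance : LambdaSub.Normal := by
  constructor
  intro n hn g
  obtain ⟨k, hk⟩ := Subgroup.mem_zpowers_iff.mp hn
  have hc : Commute g (negIT ^ k) := (negIT_central g).zpow_right k
  have : g * negIT ^ k * g⁻¹ = negIT ^ k := by
    rw [hc.eq, mul_inv_cancel_right]
  rw [← hk, this]
  exact Subgroup.mem_zpowers_iff.mpr ⟨k, rfl⟩

/-- The single relator `s²` for the presentation `⟨s, t | s² = 1⟩`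
(with `s = of 0`, `t = of 1`). -/
def pThetaRels : Set (FreeGroup (Fin 2)) := { FreeGroup.of 0 * FreeGroup.of 0 }

/-- `S⁺` as an element of `Γ_θ`. -/
def thetaS : ThetaSubgroup := ⟨Smat, Smat_mem⟩

/-- `T₂⁺` as an element of `Γ_θ`. -/
def thetaT : ThetaSubgroup := ⟨Tmat, Tmat_mem⟩

lemma theta_ext {A B : ThetaSubgroup} (h : (A : SL2Z).1 = (B : SL2Z).1) : A = B :=
  Subtype.ext (Subtype.ext h)

lemma coe_thetaS : (thetaS : SL2Z).1 = !![0, -1; 1, 0] := rfl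

lemma coe_thetaT : (thetaT : SL2Z).1 = !![1, 0; 2, 1] := rfl

lemma theta_coe_mul (A B : ThetaSubgroup) :
    ((A * B : ThetaSubgroup) : SL2Z).1 = (A : SL2Z).1 * (B : SL2Z).1 := rfl

lemma coe_thetaS_inv : ((thetaS⁻¹ : ThetaSubgroup) : SL2Z).1 = !![0, 1; -1, 0] := by
  change (Smat⁻¹).1 = _
  rw [Matrix.SpecialLinearGroup.SL2_inv_expl]
  simp [Smat]
  rfl

lemma coe_thetaT_inv : ((thetaT⁻¹ : ThetaSubgroup) : SL2Z).1 = !![1, 0; -2, 1] := by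
  change (Tmat⁻¹).1 = _
  rw [Matrix.SpecialLinearGroup.SL2_inv_expl]
  simp [Tmat]
  rfl

lemma coe_thetaT_zpow (k : ℤ) :
    ((thetaT ^ k : ThetaSubgroup) : SL2Z).1 = !![1, 0; 2 * k, 1] := by
  induction k using Int.induction_on with
  | zero => exact Matrix.one_fin_two
  | succ n ih =>
    rw [_root_.zpow_add_one, theta_coe_mul, ih, coe_thetaT]
    simp [mul_add]
  | pred n ih =>
    rw [_root_.zpow_sub_one, theta_coe_mul, ih, coe_thetaT_inv]
    simp [mul_sub]
    ring

lemma thetaS_mul_self : thetaS * thetaS = negIT := by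
  apply theta_ext
  rw [theta_coe_mul, coe_thetaS]
  change _ = Pmat.1
  simp [Pmat]

lemma theta_mk_eq_imp {A B : ThetaSubgroup}
    (h : (QuotientGroup.mk A : ThetaSubgroup ⧸ LambdaSub) = QuotientGroup.mk B) :
    (B : SL2Z).1 = (A : SL2Z).1 ∨ (B : SL2Z).1 = -(A : SL2Z).1 := by
  obtain ⟨k, hk⟩ := Subgroup.mem_zpowers_iff.mp (QuotientGroup.eq.mp h)
  have hB : B = A * negIT ^ k := by rw [hk, mul_inv_cancel_left]
  have hsq : negIT * negIT = 1 := by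
    apply theta_ext
    rw [theta_coe_mul]
    change Pmat.1 * Pmat.1 = 1
    simp [Pmat_coe]
  rcases Int.even_or_odd' k with ⟨m, rfl | rfl⟩
  · left
    rw [hB, _root_.zpow_mul, zpow_ofNat, pow_two, hsq, _root_.one_zpow, mul_one]
  · right
    rw [hB, _root_.zpow_add, _root_.zpow_mul, zpow_ofNat, pow_two, hsq, _root_.one_zpow, one_mul,
      zpow_one, theta_coe_mul]
    change _ * Pmat.1 = _
    rw [Pmat_coe, mul_neg_one]

lemma theta_det (A : ThetaSubgroup) :
    (A : SL2Z).1 0 0 * (A : SL2Z).1 1 1 - (A : SL2Z).1 0 1 * (A : SL2Z).1 1 0 = 1 := by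
  have h := (A : SL2Z).2
  rwa [Matrix.det_fin_two] at h

lemma theta_natAbs_ne (A : ThetaSubgroup) :
    ((A : SL2Z).1 0 0).natAbs ≠ ((A : SL2Z).1 1 0).natAbs := by
  intro h
  have hdet := theta_det A
  obtain ⟨h1, h2⟩ := A.2
  generalize (A : SL2Z).1 0 0 = a at *
  generalize (A : SL2Z).1 0 1 = b at *
  generalize (A : SL2Z).1 1 0 = c at *
  generalize (A : SL2Z).1 1 1 = d at *
  have hodd : ¬ (2 : ℤ) ∣ a := by
    intro ha
    have hc : (2 : ℤ) ∣ c := by omega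
    have : (2 : ℤ) ∣ a * d - b * c := dvd_sub (ha.mul_right d) (hc.mul_left b)
    omega
  have hodd' : ¬ (2 : ℤ) ∣ c := by omega
  have hb := (Int.prime_two.dvd_or_dvd h1).resolve_left hodd
  have hd := (Int.prime_two.dvd_or_dvd h2).resolve_left hodd'
  have : (2 : ℤ) ∣ a * d - b * c := dvd_sub (hd.mul_left a) (hb.mul_right c)
  omega

/-- An upper triangular element of `Γ_θ` lies in every subgroup containing `S⁺` and `T₂⁺`. -/
lemma theta_mem_of_lower_left_eq_zero {K : Subgroup ThetaSubgroup} (hS : thetaS ∈ K)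
    (hT : thetaT ∈ K) (A : ThetaSubgroup) (hc : (A : SL2Z).1 1 0 = 0) : A ∈ K := by
  have hdet := theta_det A
  obtain ⟨h1, -⟩ := A.2
  have hA := Matrix.eta_fin_two (A : SL2Z).1
  rw [hc] at hdet hA
  generalize (A : SL2Z).1 0 0 = a at *
  generalize (A : SL2Z).1 0 1 = b at *
  generalize (A : SL2Z).1 1 1 = d at *
  have had : a * d = 1 := by linarith
  rcases Int.mul_eq_one_iff_eq_one_or_neg_one.mp had with ⟨rfl, rfl⟩ | ⟨rfl, rfl⟩
  · obtain ⟨k, hk⟩ := h1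
    have : A = thetaS * thetaT ^ (-k) * thetaS⁻¹ := by
      apply theta_ext
      rw [theta_coe_mul, theta_coe_mul, coe_thetaS, coe_thetaS_inv, coe_thetaT_zpow, hA]
      simp
      linarith
    rw [this]
    exact K.mul_mem (K.mul_mem hS (K.zpow_mem hT _)) (K.inv_mem hS)
  · obtain ⟨k, hk⟩ := h1
    have : A = thetaS * thetaT ^ (-k) * thetaS := by
      apply theta_ext
      rw [theta_coe_mul, theta_coe_mul, coe_thetaS, coe_thetaT_zpow, hA]
      simp
      linarith
    rw [this]
    exact K.mul_mem (K.mul_mem hS (K.zpow_mem hT _)) hS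

/-- `S⁺` and `T₂⁺` generate `Γ_θ`. -/
lemma theta_mem_of_generators_mem {K : Subgroup ThetaSubgroup} (hS : thetaS ∈ K)
    (hT : thetaT ∈ K) (A : ThetaSubgroup) : A ∈ K := by
  induction hn : ((A : SL2Z).1 0 0).natAbs + ((A : SL2Z).1 1 0).natAbs
    using Nat.strong_induction_on generalizing A with
  | _ n ih =>
  have descend (g : ThetaSubgroup) (hg : g ∈ K)
      (hlt : (((g * A : ThetaSubgroup) : SL2Z).1 0 0).natAbs +
        (((g * A : ThetaSubgroup) : SL2Z).1 1 0).natAbs < n) : A ∈ K :=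
    (K.mul_mem_cancel_left hg).mp (ih _ hlt _ rfl)
  by_cases hc : (A : SL2Z).1 1 0 = 0
  · exact theta_mem_of_lower_left_eq_zero hS hT A hc
  by_cases ha : (A : SL2Z).1 0 0 = 0
  · refine (K.mul_mem_cancel_left hS).mp (theta_mem_of_lower_left_eq_zero hS hT _ ?_)
    rw [theta_coe_mul, coe_thetaS]
    simp [Matrix.mul_apply, Fin.sum_univ_two, ha]
  have hT' := K.inv_mem hT
  have hS' := K.inv_mem hS
  have hne := theta_natAbs_ne A
  rcases lt_or_gt_of_ne hne with hlt | hlt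
  · by_cases hsgn : (0 < (A : SL2Z).1 0 0 ↔ 0 < (A : SL2Z).1 1 0)
    · refine descend thetaT⁻¹ hT' ?_
      simp only [theta_coe_mul, coe_thetaT_inv]
      simp [Matrix.mul_apply, Fin.sum_univ_two]
      omega
    · refine descend thetaT hT ?_
      simp only [theta_coe_mul, coe_thetaT]
      simp [Matrix.mul_apply, Fin.sum_univ_two]
      omega
  · by_cases hsgn : (0 < (A : SL2Z).1 0 0 ↔ 0 < (A : SL2Z).1 1 0)
    · refine descend (thetaS * thetaT * thetaS⁻¹) (K.mul_mem (K.mul_mem hS hT) hS') ?_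
      simp only [theta_coe_mul, coe_thetaT, coe_thetaS, coe_thetaS_inv]
      simp [Matrix.mul_apply, Fin.sum_univ_two]
      omega
    · refine descend (thetaS * thetaT⁻¹ * thetaS⁻¹) (K.mul_mem (K.mul_mem hS hT') hS') ?_
      simp only [theta_coe_mul, coe_thetaT_inv, coe_thetaS, coe_thetaS_inv]
      simp [Matrix.mul_apply, Fin.sum_univ_two]
      omega

/-- Values of the alternating words `t ^ k₁ * s * t ^ k₂ * s * ⋯ * s * t ^ kₙ` with `n ≥ 1` and
all exponents nonzero. -/
inductive IsAlternating {G : Type*} [Group G] (s t : G) : G → Prop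
  | zpow (k : ℤ) (hk : k ≠ 0) : IsAlternating s t (t ^ k)
  | zpow_mul (k : ℤ) (hk : k ≠ 0) (h : G) (hh : IsAlternating s t h) :
      IsAlternating s t (t ^ k * s * h)

/-- Elements of the form `a` or `a * h * b` with `a, b ∈ {1, s}` and `h` alternating. -/
def HasNormalForm {G : Type*} [Group G] (s t g : G) : Prop :=
  g = 1 ∨ g = s ∨ ∃ a h b : G, (a = 1 ∨ a = s) ∧ (b = 1 ∨ b = s) ∧
    IsAlternating s t h ∧ g = a * h * b

lemma HasNormalForm.mul_left {G : Type*} [Group G] {s t g : G} (hs : s * s = 1)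
    (hg : HasNormalForm s t g) : HasNormalForm s t (s * g) := by
  rcases hg with rfl | rfl | ⟨a, h, b, rfl | rfl, hb, hh, rfl⟩
  · exact Or.inr (Or.inl (mul_one s))
  · exact Or.inl hs
  · exact Or.inr (Or.inr ⟨s, h, b, Or.inr rfl, hb, hh, by group⟩)
  · refine Or.inr (Or.inr ⟨1, h, b, Or.inl rfl, hb, hh, ?_⟩)
    rw [← mul_assoc, ← mul_assoc, hs]

lemma HasNormalForm.zpow_mul_left {G : Type*} [Group G] {s t g : G}
    (hg : HasNormalForm s t g) (m : ℤ) : HasNormalForm s t (t ^ m * g) := by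
  rcases eq_or_ne m 0 with rfl | hm
  · simpa using hg
  rcases hg with rfl | rfl | ⟨a, h, b, rfl | rfl, hb, hh, rfl⟩
  · exact Or.inr (Or.inr ⟨1, _, 1, Or.inl rfl, Or.inl rfl, .zpow m hm, by group⟩)
  · exact Or.inr (Or.inr ⟨1, _, g, Or.inl rfl, Or.inr rfl, .zpow m hm, by group⟩)
  · cases hh with
    | zpow k hk =>
      rcases eq_or_ne (m + k) 0 with h0 | h0
      · have : t ^ m * (1 * t ^ k * b) = b := by
          rw [one_mul, ← mul_assoc, ← _root_.zpow_add, h0, zpow_zero, one_mul]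
        rw [this]
        exact hb.imp_right Or.inl
      · exact Or.inr (Or.inr ⟨1, _, b, Or.inl rfl, hb, .zpow _ h0, by group⟩)
    | zpow_mul k hk h hh =>
      rcases eq_or_ne (m + k) 0 with h0 | h0
      · refine Or.inr (Or.inr ⟨s, h, b, Or.inr rfl, hb, hh, ?_⟩)
        rw [one_mul, ← mul_assoc, ← mul_assoc, ← mul_assoc, ← _root_.zpow_add, h0, zpow_zero, one_mul]
      · exact Or.inr (Or.inr ⟨1, _, b, Or.inl rfl, hb, .zpow_mul _ h0 h hh, by group⟩)
  · exact Or.inr (Or.inr ⟨1, _, b, Or.inl rfl, hb, .zpow_mul m hm h hh, by group⟩)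

lemma hasNormalForm_of_mem_closure {G : Type*} [Group G] {s t g : G} (hs : s * s = 1)
    (hg : g ∈ Subgroup.closure {s, t}) : HasNormalForm s t g := by
  induction hg using Subgroup.closure_induction_left with
  | one => exact Or.inl rfl
  | mul_left x hx y _ ih =>
    rcases hx with rfl | rfl
    · exact ih.mul_left hs
    · simpa using ih.zpow_mul_left 1
  | inv_mul_cancel x hx y _ ih =>
    rcases hx with rfl | rfl
    · rw [inv_eq_of_mul_eq_one_left hs]
      exact ih.mul_left hs
    · simpa using ih.zpow_mul_left (-1)

/-- An alternating word in `S` and `T₂` lifts to a matrix whose first column `(a, c)` satisfies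
`0 < |a| < |c|`. -/
lemma IsAlternating.exists_theta_lift {g : ThetaSubgroup ⧸ LambdaSub}
    (hg : IsAlternating (QuotientGroup.mk thetaS) (QuotientGroup.mk thetaT) g) :
    ∃ A : ThetaSubgroup, g = QuotientGroup.mk A ∧ 0 < |(A : SL2Z).1 0 0| ∧
      |(A : SL2Z).1 0 0| < |(A : SL2Z).1 1 0| := by
  induction hg with
  | zpow k hk =>
    refine ⟨thetaT ^ k, rfl, ?_⟩
    rw [coe_thetaT_zpow]
    have := Int.one_le_abs hk
    simp [abs_mul]
    omega
  | zpow_mul k hk h _ ih =>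
    obtain ⟨A, rfl, h0, h1⟩ := ih
    refine ⟨thetaT ^ k * thetaS * A, rfl, ?_⟩
    rw [theta_coe_mul, theta_coe_mul, coe_thetaT_zpow, coe_thetaS]
    simp only [Matrix.mul_apply, Fin.sum_univ_two]
    generalize (A : SL2Z).1 0 0 = a at *
    generalize (A : SL2Z).1 1 0 = c at *
    have hk' := Int.one_le_abs hk
    have hkc : |c| ≤ |k * c| := by
      rw [abs_mul]
      exact le_mul_of_one_le_left (abs_nonneg c) hk'
    simp
    refine ⟨by rintro rfl; simp at h1; omega, ?_⟩
    have e : a + -(2 * k * c) = a - 2 * (k * c) := by ring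
    have htri := abs_sub_abs_le_abs_sub (2 * (k * c)) a
    rw [abs_mul, abs_two] at htri
    rw [e, abs_sub_comm]
    linarith

lemma IsAlternating.map {G H : Type*} [Group G] [Group H] (f : G →* H) {s t g : G}
    (hg : IsAlternating s t g) : IsAlternating (f s) (f t) (f g) := by
  induction hg with
  | zpow k hk =>
    rw [map_zpow]
    exact .zpow k hk
  | zpow_mul k hk h _ ih =>
    rw [map_mul, map_mul, map_zpow]
    exact .zpow_mul k hk _ ih

/-- An alternating word in `S` and `T₂` is neither `1` nor `S`. -/
lemma IsAlternating.ne_one_and_ne_thetaS {g : ThetaSubgroup ⧸ LambdaSub}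
    (hg : IsAlternating (QuotientGroup.mk thetaS) (QuotientGroup.mk thetaT) g) :
    g ≠ 1 ∧ g ≠ QuotientGroup.mk thetaS := by
  obtain ⟨A, rfl, h0, h1⟩ := hg.exists_theta_lift
  constructor
  · intro h
    rcases theta_mk_eq_imp (A := 1) h.symm with h | h <;> rw [h] at h0 h1 <;> simp at h0 h1
  · intro h
    rcases theta_mk_eq_imp h.symm with h | h <;> rw [h, coe_thetaS] at h0 h1 <;> simp at h0 h1

lemma mk_thetaS_mul_self :
    (QuotientGroup.mk thetaS * QuotientGroup.mk thetaS : ThetaSubgroup ⧸ LambdaSub) = 1 := by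
  rw [← QuotientGroup.mk_mul, thetaS_mul_self, QuotientGroup.eq_one_iff]
  exact Subgroup.mem_zpowers negIT

lemma pTheta_lift_rel : ∀ r ∈ pThetaRels,
    FreeGroup.lift (![QuotientGroup.mk thetaS, QuotientGroup.mk thetaT] :
      Fin 2 → ThetaSubgroup ⧸ LambdaSub) r = 1 := by
  rintro r rfl
  simpa using mk_thetaS_mul_self

/-- The homomorphism `⟨s, t | s²⟩ → PΓ_θ` with `s ↦ S` and `t ↦ T₂`. -/
def pThetaHom : PresentedGroup pThetaRels →* ThetaSubgroup ⧸ LambdaSub :=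
  PresentedGroup.toGroup pTheta_lift_rel

lemma pThetaHom_of_zero : pThetaHom (PresentedGroup.of 0) = QuotientGroup.mk thetaS :=
  PresentedGroup.toGroup.of pTheta_lift_rel

lemma pThetaHom_of_one : pThetaHom (PresentedGroup.of 1) = QuotientGroup.mk thetaT :=
  PresentedGroup.toGroup.of pTheta_lift_rel

lemma pThetaHom_surjective : Function.Surjective pThetaHom := by
  intro q
  obtain ⟨A, rfl⟩ := QuotientGroup.mk_surjective q
  exact theta_mem_of_generators_mem
    (K := pThetaHom.range.comap (QuotientGroup.mk' LambdaSub))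
    ⟨_, pThetaHom_of_zero⟩ ⟨_, pThetaHom_of_one⟩ A

lemma pThetaHom_injective : Function.Injective pThetaHom := by
  rw [injective_iff_map_eq_one]
  intro g hg
  have hs : (PresentedGroup.of 0 * PresentedGroup.of 0 : PresentedGroup pThetaRels) = 1 :=
    PresentedGroup.one_of_mem (rels := pThetaRels) rfl
  have hmem : g ∈ Subgroup.closure
      {(PresentedGroup.of 0 : PresentedGroup pThetaRels), PresentedGroup.of 1} := by
    have hr : Set.range (PresentedGroup.of (rels := pThetaRels)) =
        {PresentedGroup.of 0, PresentedGroup.of 1} := by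
      ext x
      simp [Fin.exists_fin_two, eq_comm]
    rw [← hr, PresentedGroup.closure_range_of]
    exact Subgroup.mem_top g
  rcases hasNormalForm_of_mem_closure hs hmem with h | rfl | ⟨a, h, b, ha, hb, hh, rfl⟩
  · exact h
  · rw [pThetaHom_of_zero] at hg
    rcases theta_mk_eq_imp (A := 1) hg.symm with h | h <;>
      simpa [coe_thetaS] using congrFun (congrFun h 1) 0
  · have hh' := hh.map pThetaHom
    rw [pThetaHom_of_zero, pThetaHom_of_one] at hh'
    obtain ⟨h1, hS⟩ := hh'.ne_one_and_ne_thetaS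
    have hinv : (QuotientGroup.mk thetaS : ThetaSubgroup ⧸ LambdaSub)⁻¹ =
        QuotientGroup.mk thetaS := inv_eq_of_mul_eq_one_left mk_thetaS_mul_self
    rw [map_mul, map_mul, mul_eq_one_iff_eq_inv, ← eq_inv_mul_iff_mul_eq] at hg
    rcases ha with rfl | rfl <;> rcases hb with rfl | rfl <;>
      simp only [map_one, inv_one, one_mul, mul_one, pThetaHom_of_zero, hinv,
        mk_thetaS_mul_self] at hg
    · exact absurd hg h1
    · exact absurd hg hS
    · exact absurd hg hS
    · exact absurd hg h1

/-- `PΓ_θ = Γ_θ/Λ` has the presentation `⟨S, T₂ | S² = 1⟩`: there is a group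
isomorphism from the presented group to `PΓ_θ` sending `s ↦ S` and `t ↦ T₂`, where `S`, `T₂`
are the images of `S⁺` and `T₂⁺` in the quotient. -/
theorem ptheta_presentation :
    ∃ φ : PresentedGroup pThetaRels ≃* (ThetaSubgroup ⧸ LambdaSub),
      φ (PresentedGroup.of 0) = QuotientGroup.mk (⟨Smat, Smat_mem⟩ : ThetaSubgroup) ∧
      φ (PresentedGroup.of 1) = QuotientGroup.mk (⟨Tmat, Tmat_mem⟩ : ThetaSubgroup) := by
  exact ⟨MulEquiv.ofBijective pThetaHom ⟨pThetaHom_injective, pThetaHom_surjective⟩,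
    pThetaHom_of_zero, pThetaHom_of_one⟩
end
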